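/- arXiv:2601.09643 — 2 statements merged into one kernel-verified Lean document; each statement's English description precedes it below -/
import Mathlib

section
/- Let 𝔛 be a class of torsion solvable groups that is closed under taking subgroups and quotients. If the Addition Theorem holds in 𝔛 for endomorphisms (i.e. AT(G,φ,H) holds for every G ∈ 𝔛, every endomorphism φ of G and every φ-invariant normal subgroup H of G), then for every G ∈ 𝔛 and every endomorphism φ of G, either h(φ) = ∞ or h(φ) = log(α) for some positive integer α. -/
open scoped Pointwise ENNReal

/-- A group is *locally finite* if every finitely generated subgroup is finite. -/
def IsLocallyFinite (G : Type*) [Group G] : Prop :=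
  ∀ S : Set G, S.Finite → (Subgroup.closure S : Set G).Finite

namespace AlgEntropy

variable {G : Type*} [Group G]

/-- `entTraj φ F n` is the `n`-th trajectory `T_n(φ,F) = F·φ(F)···φ^{n-1}(F)`
(with `T_0 = {1}`). -/
def entTraj (φ : G →* G) (F : Set G) : ℕ → Set G
  | 0 => {1}
  | n + 1 => entTraj φ F n * (⇑φ)^[n] '' F

/-- The algebraic entropy of `φ` with respect to a subgroup `F`:
`H(φ,F) = lim_n (1/n)·log|T_n(φ,F)|` (the limit exists when `G` is locally
finite and `F` is finite, and then it coincides with this `limsup`). -/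
noncomputable def entH (φ : G →* G) (F : Subgroup G) : ℝ :=
  Filter.limsup (fun n : ℕ => Real.log (entTraj φ (F : Set G) n).ncard / n) Filter.atTop

/-- The algebraic entropy `h(φ) = sup { H(φ,F) : F ≤ G finite }`, valued in `[0,∞]`. -/
noncomputable def algEnt (φ : G →* G) : ℝ≥0∞ :=
  ⨆ (F : Subgroup G) (_ : (F : Set G).Finite), ENNReal.ofReal (entH φ F)

/-- The restriction of an endomorphism `φ` to a `φ`-invariant subgroup `H`. -/
def endRestrict (φ : G →* G) (H : Subgroup G) (hH : H ≤ H.comap φ) : H →* H :=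
  (φ.domRestrict H).codRestrict H (fun x => hH x.2)

/-- The entropy of the endomorphism induced by `φ` on the quotient `G ⧸ H`. -/
noncomputable def entQuot (φ : G →* G) (H : Subgroup G) (hN : H.Normal)
    (hH : H ≤ H.comap φ) : ℝ≥0∞ :=
  letI := hN
  algEnt (QuotientGroup.map H H φ hH)

/-- The Addition Theorem `AT(G,φ,H)`:
`h(φ) = h(φ↾_H) + h(φ̄)` where `φ̄` is induced by `φ` on `G ⧸ H`. -/
def AT (φ : G →* G) (H : Subgroup G) (hN : H.Normal) (hH : H ≤ H.comap φ) : Prop :=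
  algEnt φ = algEnt (endRestrict φ H hH) + entQuot φ H hN hH

lemma commutator_le_comap (φ : G →* G) :
    commutator G ≤ (commutator G).comap φ := by
  rw [← Subgroup.map_le_iff_le_comap]
  calc Subgroup.map φ (commutator G) = ⁅Subgroup.map φ ⊤, Subgroup.map φ ⊤⁆ :=
        Subgroup.map_commutator ⊤ ⊤ φ
    _ ≤ commutator G := Subgroup.commutator_mono le_top le_top

lemma normal_of_le_center {N : Subgroup G} (h : N ≤ Subgroup.center G) : N.Normal := by
  constructor
  intro n hn g
  have hc := Subgroup.mem_center_iff.mp (h hn) g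
  have : g * n * g⁻¹ = n := by
    rw [hc]; group
  rwa [this]

lemma center_le_comap_equiv (φ : G ≃* G) :
    Subgroup.center G ≤ (Subgroup.center G).comap φ.toMonoidHom := by
  intro x hx
  simp only [Subgroup.mem_comap]
  refine Subgroup.mem_center_iff.mpr fun g => ?_
  have hg : φ (φ.symm g) = g := φ.apply_symm_apply g
  calc g * φ x = φ (φ.symm g) * φ x := by rw [hg]
    _ = φ (φ.symm g * x) := by rw [map_mul]
    _ = φ (x * φ.symm g) := by rw [Subgroup.mem_center_iff.mp hx (φ.symm g)]
    _ = φ x * g := by rw [map_mul, hg]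

lemma lowerCentralSeries_le_comap (φ : G →* G) (n : ℕ) :
    (⊤ : Subgroup G).lowerCentralSeries n ≤ ((⊤ : Subgroup G).lowerCentralSeries n).comap φ := by
  rw [← Subgroup.map_le_iff_le_comap]
  induction n with
  | zero => exact le_top
  | succ n ih =>
      show Subgroup.map φ ⁅(⊤ : Subgroup G).lowerCentralSeries n, ⊤⁆ ≤
        ⁅(⊤ : Subgroup G).lowerCentralSeries n, ⊤⁆
      rw [Subgroup.map_commutator]
      exact Subgroup.commutator_mono ih le_top

lemma upperCentralSeries_le_comap (φ : G ≃* G) (n : ℕ) :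
    upperCentralSeries G n ≤ (upperCentralSeries G n).comap φ.toMonoidHom := by
  have := comap_upperCentralSeries φ n
  -- `(upperCentralSeries G n).comap φ = upperCentralSeries G n`
  exact le_of_eq this.symm

end AlgEntropy

namespace AlgEntropy

def tSub {A : Type*} [CommGroup A] (φ : A →* A) (F : Subgroup A) : ℕ → Subgroup A
  | 0 => ⊥
  | n + 1 => F ⊔ (tSub φ F n).map φ

def iterHom {A : Type*} [CommGroup A] (φ : A →* A) : ℕ → (A →* A)
  | 0 => MonoidHom.id A
  | n + 1 => φ.comp (iterHom φ n)

lemma coe_iterHom {A : Type*} [CommGroup A] (φ : A →* A) (n : ℕ) :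
    ⇑(iterHom φ n) = (⇑φ)^[n] := by
  induction n with
  | zero => rfl
  | succ n ih => rw [iterHom, MonoidHom.coe_comp, ih, Function.iterate_succ']

lemma tSub_succ' {A : Type*} [CommGroup A] (φ : A →* A) (F : Subgroup A) (n : ℕ) :
    tSub φ F (n + 1) = tSub φ F n ⊔ F.map (iterHom φ n) := by
  induction n with
  | zero => simp [tSub, iterHom]
  | succ n ih =>
    rw [iterHom, ← Subgroup.map_map]
    conv_lhs => rw [tSub, ih, Subgroup.map_sup, ← sup_assoc]
    conv_rhs => rw [tSub]

lemma coe_tSub {A : Type*} [CommGroup A] (φ : A →* A) (F : Subgroup A) (n : ℕ) :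
    (tSub φ F n : Set A) = entTraj φ (F : Set A) n := by
  induction n with
  | zero => simp [tSub, entTraj]
  | succ n ih =>
    rw [tSub_succ', Subgroup.mul_normal, ih, entTraj, Subgroup.coe_map, coe_iterHom]

lemma tSub_finite {A : Type*} [CommGroup A] (φ : A →* A) (F : Subgroup A)
    (hF : (F : Set A).Finite) (n : ℕ) : (tSub φ F n : Set A).Finite := by
  rw [coe_tSub]
  induction n with
  | zero => simp [entTraj]
  | succ n ih => exact ih.mul (hF.image _)

lemma tSub_le {A : Type*} [CommGroup A] (φ : A →* A) (F : Subgroup A) (n : ℕ) :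
    tSub φ F n ≤ tSub φ F (n + 1) := by
  rw [tSub_succ']; exact le_sup_left

lemma relIndex_ne {A : Type*} [CommGroup A] (φ : A →* A) (F : Subgroup A)
    (hF : (F : Set A).Finite) (n : ℕ) : (tSub φ F n).relIndex (tSub φ F (n + 1)) ≠ 0 := by
  have : Finite (tSub φ F (n + 1)) := tSub_finite φ F hF (n + 1)
  exact Subgroup.index_ne_zero_of_finite

lemma relIndex_anti {A : Type*} [CommGroup A] (φ : A →* A) (F : Subgroup A)
    (hF : (F : Set A).Finite) :
    Antitone fun n => (tSub φ F n).relIndex (tSub φ F (n + 1)) := by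
  refine antitone_nat_of_succ_le fun n => ?_
  apply Nat.le_of_dvd (Nat.pos_of_ne_zero (relIndex_ne φ F hF n))
  have h1 : tSub φ F (n + 1 + 1) = (tSub φ F (n + 1)).map φ ⊔ tSub φ F (n + 1) := by
    apply le_antisymm
    · conv_lhs => rw [tSub]
      refine sup_le ?_ le_sup_left
      refine le_trans ?_ le_sup_right
      rw [tSub]; exact le_sup_left
    · refine sup_le ?_ (tSub_le _ _ _)
      conv_rhs => rw [tSub]
      exact le_sup_right
  have h2 : (tSub φ F n).map φ ≤ tSub φ F (n + 1) := by
    rw [tSub]; exact le_sup_right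
  rw [h1, Subgroup.relIndex_sup_right]
  refine (Subgroup.relIndex_dvd_of_le_left _ h2).trans ?_
  rw [Subgroup.relIndex_map_map]
  have h3 : tSub φ F (n + 1) ⊔ φ.ker = φ.ker ⊔ tSub φ F (n + 1) := sup_comm _ _
  have h4 : (tSub φ F n ⊔ φ.ker).relIndex (tSub φ F (n + 1) ⊔ φ.ker)
      = (tSub φ F n ⊔ φ.ker).relIndex (tSub φ F (n + 1)) := by
    have : tSub φ F (n + 1) ⊔ φ.ker = tSub φ F (n + 1) ⊔ (tSub φ F n ⊔ φ.ker) := by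
      rw [← sup_assoc, sup_eq_left.2 (tSub_le φ F n)]
    rw [this, Subgroup.relIndex_sup_right]
  rw [h4]
  exact Subgroup.relIndex_dvd_of_le_left _ le_sup_left

lemma log_card {A : Type*} [CommGroup A] (φ : A →* A) (F : Subgroup A)
    (hF : (F : Set A).Finite) (n : ℕ) :
    Real.log (entTraj φ (F : Set A) n).ncard =
      ∑ i ∈ Finset.range n, Real.log ((tSub φ F i).relIndex (tSub φ F (i + 1))) := by
  have key : ∀ n, (entTraj φ (F : Set A) n).ncard = Nat.card (tSub φ F n) := by
    intro n
    rw [← coe_tSub, ← Nat.card_coe_set_eq]; rfl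
  induction n with
  | zero => simp [entTraj]
  | succ n ih =>
    rw [Finset.sum_range_succ, ← ih, key, key]
    have h := Subgroup.relIndex_mul_relIndex ⊥ (tSub φ F n) (tSub φ F (n + 1)) bot_le
      (tSub_le φ F n)
    rw [Subgroup.relIndex_bot_left, Subgroup.relIndex_bot_left] at h
    have hfin : Finite (tSub φ F n) := tSub_finite φ F hF n
    rw [← h, Nat.cast_mul, Real.log_mul]
    · exact_mod_cast Nat.card_pos.ne'
    · exact_mod_cast relIndex_ne φ F hF n

lemma entH_eq {A : Type*} [CommGroup A] (φ : A →* A) (F : Subgroup A)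
    (hF : (F : Set A).Finite) : ∃ b : ℕ, 0 < b ∧ entH φ F = Real.log b := by
  let c : ℕ → ℕ := fun n => (tSub φ F n).relIndex (tSub φ F (n + 1))
  have hanti : Antitone c := relIndex_anti φ F hF
  obtain ⟨N, hN⟩ := Nat.sInf_mem (Set.range_nonempty c)
  have hconst : ∀ n, N ≤ n → c n = c N := fun n hn =>
    le_antisymm (hanti hn) (by rw [hN]; exact Nat.sInf_le ⟨n, rfl⟩)
  refine ⟨c N, Nat.pos_of_ne_zero (relIndex_ne φ F hF N), ?_⟩
  have ht : Filter.Tendsto (fun n => Real.log (c n)) Filter.atTop (nhds (Real.log (c N))) := by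
    refine tendsto_const_nhds.congr' ?_
    filter_upwards [Filter.eventually_ge_atTop N] with n hn
    rw [hconst n hn]
  have h := ht.cesaro
  unfold entH
  refine Filter.Tendsto.limsup_eq (h.congr fun n => ?_)
  rw [log_card φ F hF n, div_eq_inv_mul]

lemma algEnt_comm {A : Type*} [CommGroup A] (φ : A →* A) :
    algEnt φ = ⊤ ∨ ∃ α : ℕ+, algEnt φ = ENNReal.ofReal (Real.log α) := by
  classical
  have hb : ∀ F : Subgroup A, ∃ b : ℕ, 0 < b ∧ ((F : Set A).Finite → entH φ F = Real.log b) := by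
    intro F
    by_cases hF : (F : Set A).Finite
    · obtain ⟨b, h0, h⟩ := entH_eq φ F hF
      exact ⟨b, h0, fun _ => h⟩
    · exact ⟨1, one_pos, fun h => absurd h hF⟩
  choose b hb0 hb using hb
  let S : Set ℕ := b '' {F | (F : Set A).Finite}
  have hSne : S.Nonempty := ⟨_, ⊥, by simp, rfl⟩
  by_cases hS : BddAbove S
  · right
    have hmem := Nat.sSup_mem hSne hS
    obtain ⟨F, hF, hFe⟩ := hmem
    refine ⟨⟨b F, hb0 F⟩, le_antisymm ?_ ?_⟩
    · refine iSup₂_le fun K hK => ENNReal.ofReal_le_ofReal ?_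
      rw [hb K hK]
      apply Real.log_le_log (by exact_mod_cast hb0 K)
      have : b K ≤ b F := by rw [hFe]; exact le_csSup hS ⟨K, hK, rfl⟩
      exact_mod_cast this
    · have := le_iSup₂ (f := fun (F : Subgroup A) (_ : (F : Set A).Finite) =>
        ENNReal.ofReal (entH φ F)) F hF
      simp only [hb F hF] at this
      exact this
  · left
    refine ENNReal.eq_top_of_forall_nnreal_le fun r => ?_
    obtain ⟨m, hm⟩ := exists_nat_gt (Real.exp r)
    rw [not_bddAbove_iff] at hS
    obtain ⟨_, ⟨F, hF, rfl⟩, hlt⟩ := hS m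
    have h1 := le_iSup₂ (f := fun (F : Subgroup A) (_ : (F : Set A).Finite) =>
        ENNReal.ofReal (entH φ F)) F hF
    refine le_trans ?_ h1
    rw [hb F hF, ← ENNReal.ofReal_coe_nnreal]
    apply ENNReal.ofReal_le_ofReal
    rw [Real.le_log_iff_exp_le (by exact_mod_cast hb0 F)]
    have : (m : ℝ) < b F := by exact_mod_cast hlt
    linarith

lemma algEnt_comm' {A : Type*} [inst : Group A] (hc : ∀ a b : A, a * b = b * a) (φ : A →* A) :
    algEnt φ = ⊤ ∨ ∃ α : ℕ+, algEnt φ = ENNReal.ofReal (Real.log α) :=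
  @algEnt_comm A { inst with mul_comm := hc } φ

end AlgEntropy

universe u

/-- Let `𝔛` be a class of torsion solvable groups closed under subgroups
and quotients. If the Addition Theorem holds in `𝔛` for endomorphisms, then for every
`G ∈ 𝔛` and every endomorphism `φ` of `G`, either `h(φ) = ∞` or `h(φ) = log α` for some
positive integer `α`. -/
theorem algEnt_eq_log_nat_of_AT_class
    (X : (G : Type u) → [inst : Group G] → Prop)
    (hX_tor : ∀ (G : Type u) [Group G], X G → Monoid.IsTorsion G)
    (hX_solv : ∀ (G : Type u) [Group G], X G → IsSolvable G)
    (hX_sub : ∀ (G : Type u) [Group G], X G → ∀ H : Subgroup G, X H)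
    (hX_quot : ∀ (G : Type u) [Group G], X G → ∀ (H : Subgroup G) [H.Normal], X (G ⧸ H))
    (hAT : ∀ (G : Type u) [Group G], X G → ∀ (φ : G →* G) (H : Subgroup G)
      (hN : H.Normal) (hH : H ≤ H.comap φ), AlgEntropy.AT φ H hN hH)
    (G : Type u) [Group G] (hG : X G) (φ : G →* G) :
    AlgEntropy.algEnt φ = ⊤ ∨
      ∃ α : ℕ+, AlgEntropy.algEnt φ = ENNReal.ofReal (Real.log α) := by
  obtain ⟨n, hn⟩ := (hX_solv G hG).solvable
  induction n generalizing G with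
  | zero =>
    apply AlgEntropy.algEnt_comm'
    intro a b
    have h : ∀ x : G, x = 1 := fun x => by
      have hx : x ∈ derivedSeries G 0 := by simp
      rw [hn] at hx
      simpa using hx
    rw [h a, h b]
  | succ n ih =>
    have hH : derivedSeries G n ≤ (derivedSeries G n).comap φ :=
      Subgroup.map_le_iff_le_comap.1 (map_derivedSeries_le_derivedSeries φ n)
    have hN : (derivedSeries G n).Normal := derivedSeries_normal G n
    have h := hAT G hG φ (derivedSeries G n) hN hH
    unfold AlgEntropy.AT AlgEntropy.entQuot at h
    have h1 := AlgEntropy.algEnt_comm' (A := derivedSeries G n) (by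
      intro a b
      rw [derivedSeries_succ, Subgroup.commutator_eq_bot_iff_le_centralizer] at hn
      apply Subtype.ext
      exact (Subgroup.mem_centralizer_iff.1 (hn b.2) a a.2))
      (AlgEntropy.endRestrict φ (derivedSeries G n) hH)
    have h2 := ih (G ⧸ derivedSeries G n) (hX_quot G hG _)
      (QuotientGroup.map _ _ φ hH) (by
        rw [← map_derivedSeries_eq (QuotientGroup.mk'_surjective (derivedSeries G n)),
          Subgroup.map_eq_bot_iff, QuotientGroup.ker_mk'])
    rw [h]
    rcases h1 with h1 | ⟨a, h1⟩
    · left; rw [h1]; simp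
    rcases h2 with h2 | ⟨b, h2⟩
    · left; rw [h2]; simp
    right
    refine ⟨a * b, ?_⟩
    have ha : (1 : ℝ) ≤ (a : ℕ) := by exact_mod_cast a.2
    have hb : (1 : ℝ) ≤ (b : ℕ) := by exact_mod_cast b.2
    rw [h1, h2, ← ENNReal.ofReal_add (Real.log_nonneg ha) (Real.log_nonneg hb),
      PNat.mul_coe, Nat.cast_mul, Real.log_mul (by linarith) (by linarith)]
end

section
/- Let G be a torsion nilpotent group and let φ be an endomorphism of G with finite algebraic entropy, h(φ) < ∞. Then h(φ) = log(α) for some positive integer α. -/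
open scoped Pointwise ENNReal

namespace AlgEntropy

section general
variable {G : Type*} [Group G]

/-- The one step index `[F : F ∩ φ⁻¹(F)]`. -/
noncomputable def idx (φ : G →* G) (F : Subgroup G) : ℕ := (F.comap φ).relIndex F

/-- Good subgroups exist above each finite set. -/
def Good (φ : G →* G) : Prop :=
  ∀ S : Set G, S.Finite → ∃ F : Subgroup G, S ⊆ F ∧ (F : Set G).Finite ∧
    ∀ n, idx φ F ^ n ≤ (entTraj φ (F : Set G) n).ncard

lemma relIndex_ne_zero_of_finite (H K : Subgroup G) (hK : (K : Set G).Finite) :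
    H.relIndex K ≠ 0 := by
  have : Finite K := hK
  exact ne_zero_of_dvd_ne_zero Nat.card_pos.ne' (Subgroup.relIndex_dvd_card H K)

lemma entTraj_finite (φ : G →* G) {F : Set G} (hF : F.Finite) (n : ℕ) :
    (entTraj φ F n).Finite := by
  induction n with
  | zero => exact Set.finite_singleton 1
  | succ n ih => exact ih.mul (hF.image _)

lemma entTraj_mono (φ : G →* G) {F F' : Set G} (h : F ⊆ F') (n : ℕ) :
    entTraj φ F n ⊆ entTraj φ F' n := by
  induction n with
  | zero => exact subset_rfl
  | succ n ih => exact Set.mul_subset_mul ih (Set.image_mono h)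

lemma one_mem_entTraj (φ : G →* G) (F : Subgroup G) (n : ℕ) :
    1 ∈ entTraj φ (F : Set G) n := by
  induction n with
  | zero => rfl
  | succ n ih => exact ⟨1, ih, 1, ⟨1, F.one_mem, by simp⟩, by simp⟩

lemma entTraj_ncard_pos (φ : G →* G) (F : Subgroup G) (hF : (F : Set G).Finite) (n : ℕ) :
    0 < (entTraj φ (F : Set G) n).ncard :=
  (Set.ncard_pos (entTraj_finite φ hF n)).2 ⟨1, one_mem_entTraj φ F n⟩

lemma ncard_mul_le' (s t : Set G) : (s * t).ncard ≤ s.ncard * t.ncard := by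
  simpa only [Nat.card_coe_set_eq] using Set.natCard_mul_le (s := s) (t := t)

lemma entTraj_upper (φ : G →* G) (F : Subgroup G) (hF : (F : Set G).Finite) (n : ℕ) :
    (entTraj φ (F : Set G) (n + 1)).ncard ≤ (F : Set G).ncard * idx φ F ^ n := by
  induction n with
  | zero => simp [entTraj]
  | succ n ih =>
    have : Finite F := hF
    obtain ⟨R, hR, hRc⟩ := Subgroup.exists_right_transversal_of_le
      (H' := F ⊓ F.comap φ) (H := F) inf_le_left
    have hcard : Nat.card R = idx φ F := by
      have h1 := Subgroup.relIndex_mul_relIndex (⊥ : Subgroup G) (F ⊓ F.comap φ) F bot_le inf_le_left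
      rw [Subgroup.relIndex_bot_left, Subgroup.relIndex_bot_left, Subgroup.inf_relIndex_left] at h1
      have hpos : 0 < Nat.card (F ⊓ F.comap φ : Subgroup G) := by
        have : Finite (F ⊓ F.comap φ : Subgroup G) := Set.Finite.subset hF (fun x hx => hx.1)
        exact Nat.card_pos
      exact Nat.eq_of_mul_eq_mul_left hpos (hRc.trans h1.symm)
    have hRF : R ⊆ F := by
      rw [← hR]; intro r hr; exact ⟨1, Subgroup.one_mem _, r, hr, by simp⟩
    have hRfin : R.Finite := hF.subset hRF
    have hsub : entTraj φ (F : Set G) (n + 1 + 1) ⊆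
        entTraj φ (F : Set G) (n + 1) * (⇑φ)^[n + 1] '' R := by
      rintro _ ⟨_, ⟨t, ht, _, ⟨f, hf, rfl⟩, rfl⟩, _, ⟨f', hf', rfl⟩, rfl⟩
      rw [← hR] at hf'
      obtain ⟨d, hd, r, hr, rfl⟩ := hf'
      refine ⟨t * (⇑φ)^[n] (f * φ d), ⟨t, ht, _, ⟨_, F.mul_mem hf hd.2, rfl⟩, rfl⟩,
        _, ⟨r, hr, rfl⟩, ?_⟩
      simp only [iterate_map_mul, Function.iterate_succ_apply, mul_assoc, map_mul]
    calc _ ≤ (entTraj φ (F : Set G) (n + 1) * (⇑φ)^[n + 1] '' R).ncard :=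
          Set.ncard_le_ncard hsub ((entTraj_finite φ hF _).mul (hRfin.image _))
      _ ≤ (entTraj φ (F : Set G) (n + 1)).ncard * ((⇑φ)^[n + 1] '' R).ncard := ncard_mul_le' _ _
      _ ≤ ((F : Set G).ncard * idx φ F ^ n) * idx φ F := by
          refine Nat.mul_le_mul ih ?_
          rw [← hcard, Nat.card_coe_set_eq]
          exact Set.ncard_image_le hRfin
      _ = _ := by ring

lemma idx_pos (φ : G →* G) (F : Subgroup G) (hF : (F : Set G).Finite) : 0 < idx φ F :=
  Nat.pos_of_ne_zero (relIndex_ne_zero_of_finite _ _ hF)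

lemma upper_tendsto (c d : ℝ) :
    Filter.Tendsto (fun n : ℕ => (c + n * d) / n) Filter.atTop (nhds d) := by
  have h1 : Filter.Tendsto (fun n : ℕ => c / (n : ℝ) + d) Filter.atTop (nhds (0 + d)) :=
    (tendsto_const_div_atTop_nhds_zero_nat c).add_const d
  rw [zero_add] at h1
  refine h1.congr' ?_
  filter_upwards [Filter.eventually_gt_atTop 0] with n hn
  have : (n : ℝ) ≠ 0 := by positivity
  field_simp

lemma log_le (φ : G →* G) (F : Subgroup G) (hF : (F : Set G).Finite) (n : ℕ) :
    Real.log (entTraj φ (F : Set G) n).ncard / n ≤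
      (Real.log (F : Set G).ncard + n * Real.log (idx φ F)) / n := by
  have hi := idx_pos φ F hF
  have hc : 0 < (F : Set G).ncard := (Set.ncard_pos hF).2 ⟨1, F.one_mem⟩
  rcases n with _ | n
  · simp
  have h := entTraj_upper φ F hF n
  have hp := entTraj_ncard_pos φ F hF (n + 1)
  have h2 : (entTraj φ (F : Set G) (n + 1)).ncard ≤ (F : Set G).ncard * idx φ F ^ (n + 1) :=
    h.trans (Nat.mul_le_mul_left _ (Nat.pow_le_pow_right hi (Nat.le_succ n)))
  have h3 : Real.log (entTraj φ (F : Set G) (n + 1)).ncard ≤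
      Real.log ((F : Set G).ncard * idx φ F ^ (n + 1)) := by
    apply Real.log_le_log (by exact_mod_cast hp)
    exact_mod_cast h2
  rw [Real.log_mul (by positivity) (by positivity), Real.log_pow] at h3
  gcongr

lemma entH_le (φ : G →* G) (F₀ F : Subgroup G) (hF : (F : Set G).Finite) (h : F₀ ≤ F) :
    entH φ F₀ ≤ Real.log (idx φ F) := by
  have hF₀ : (F₀ : Set G).Finite := hF.subset h
  have ht := upper_tendsto (Real.log (F : Set G).ncard) (Real.log (idx φ F))
  rw [entH, ← ht.limsup_eq]
  refine Filter.limsup_le_limsup (Filter.Eventually.of_forall fun n => ?_) ?_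
    ht.isBoundedUnder_le
  · refine le_trans ?_ (log_le φ F hF n)
    have hp := entTraj_ncard_pos φ F₀ hF₀ n
    have := Set.ncard_le_ncard (entTraj_mono φ (show (F₀ : Set G) ⊆ F from h) n)
      (entTraj_finite φ hF n)
    exact div_le_div_of_nonneg_right (Real.log_le_log (by exact_mod_cast hp)
      (by exact_mod_cast this)) (Nat.cast_nonneg n)
  · apply Filter.IsCoboundedUnder.of_frequently_ge (a := 0)
    refine Filter.Frequently.of_forall fun n => ?_
    have hp := entTraj_ncard_pos φ F₀ hF₀ n
    exact div_nonneg (Real.log_natCast_nonneg _) (Nat.cast_nonneg _)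

lemma le_entH (φ : G →* G) (F : Subgroup G) (hF : (F : Set G).Finite)
    (h : ∀ n, idx φ F ^ n ≤ (entTraj φ (F : Set G) n).ncard) :
    Real.log (idx φ F) ≤ entH φ F := by
  have ht := upper_tendsto (Real.log (F : Set G).ncard) (Real.log (idx φ F))
  have hi := idx_pos φ F hF
  apply Filter.le_limsup_of_frequently_le
  · apply Filter.Eventually.frequently
    filter_upwards [Filter.eventually_gt_atTop 0] with n hn
    rw [le_div_iff₀ (by positivity), mul_comm, ← Real.log_pow]
    apply Real.log_le_log (by positivity)
    exact_mod_cast h n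
  · exact ht.isBoundedUnder_le.mono_le (Filter.Eventually.of_forall (log_le φ F hF))

theorem final (φ : G →* G) (hg : Good φ) (hfin : algEnt φ < ⊤) :
    ∃ α : ℕ+, algEnt φ = ENNReal.ofReal (Real.log α) := by
  set A : Set ℕ := {a | ∃ F : Subgroup G, (F : Set G).Finite ∧
    (∀ n, idx φ F ^ n ≤ (entTraj φ (F : Set G) n).ncard) ∧ idx φ F = a} with hA
  have hle : ∀ a ∈ A, ENNReal.ofReal (Real.log a) ≤ algEnt φ := by
    rintro a ⟨F, hF, h, rfl⟩
    exact (ENNReal.ofReal_le_ofReal (le_entH φ F hF h)).trans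
      (le_iSup₂_of_le (f := fun (F : Subgroup G) (_ : (F : Set G).Finite) =>
        ENNReal.ofReal (entH φ F)) F hF le_rfl)
  have hne : A.Nonempty := by
    obtain ⟨F, -, hF, h⟩ := hg ∅ Set.finite_empty
    exact ⟨_, F, hF, h, rfl⟩
  have hpos : ∀ a ∈ A, 0 < a := by
    rintro a ⟨F, hF, h, rfl⟩
    exact idx_pos φ F hF
  have hb : BddAbove A := by
    refine ⟨⌈Real.exp (algEnt φ).toReal⌉₊, fun a ha => ?_⟩
    have h1 := hle a ha
    rw [ENNReal.ofReal_le_iff_le_toReal hfin.ne] at h1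
    have hp := hpos a ha
    rw [Real.log_le_iff_le_exp (by exact_mod_cast hp)] at h1
    exact_mod_cast h1.trans (Nat.le_ceil _)
  have hm := Nat.sSup_mem hne hb
  refine ⟨⟨sSup A, hpos _ hm⟩, le_antisymm ?_ (hle _ hm)⟩
  refine iSup₂_le fun F₀ hF₀ => ENNReal.ofReal_le_ofReal ?_
  obtain ⟨F, h0, hF, h⟩ := hg F₀ hF₀
  refine (entH_le φ F₀ F hF h0).trans ?_
  have hi := idx_pos φ F hF
  apply Real.log_le_log (by exact_mod_cast hi)
  have : idx φ F ≤ sSup A := le_csSup hb ⟨F, hF, h, rfl⟩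
  exact_mod_cast this

lemma image_entTraj {K : Type*} [Group K] (φ : G →* G) (ψ : K →* K) (f : G →* K)
    (hc : ∀ x, f (φ x) = ψ (f x)) (F : Set G) (n : ℕ) :
    f '' entTraj φ F n = entTraj ψ (f '' F) n := by
  have hit : ∀ n x, f ((⇑φ)^[n] x) = (⇑ψ)^[n] (f x) := fun n x =>
    (Function.Semiconj.iterate_right (f := f) (ga := φ) (gb := ψ) hc n) x
  induction n with
  | zero => simp [entTraj]
  | succ n ih =>
    simp only [entTraj, Set.image_mul, ih, Set.image_image, hit]

lemma entTraj_mul_central (φ : G →* G) (F : Subgroup G) (K : Set G) (hK : K ⊆ F)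
    (hcen : ∀ n, ∀ x ∈ K, (⇑φ)^[n] x ∈ Subgroup.center G) (n : ℕ) :
    entTraj φ (F : Set G) n * entTraj φ K n ⊆ entTraj φ (F : Set G) n := by
  induction n with
  | zero => simp [entTraj]
  | succ n ih =>
    have hTc : ∀ n, entTraj φ K n ⊆ Subgroup.center G := by
      intro n
      induction n with
      | zero => simp [entTraj]
      | succ n ih =>
        rintro _ ⟨a, ha, _, ⟨b, hb, rfl⟩, rfl⟩
        exact Subgroup.mul_mem _ (ih ha) (hcen n b hb)
    rintro _ ⟨_, ⟨a, ha, _, ⟨f, hf, rfl⟩, rfl⟩, _, ⟨b, hb, _, ⟨k, hk, rfl⟩, rfl⟩, rfl⟩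
    refine ⟨a * b, ih ⟨a, ha, b, hb, rfl⟩, _, ⟨f * k, F.mul_mem hf (hK hk), rfl⟩, ?_⟩
    have hb' := Subgroup.mem_center_iff.1 (hTc n hb) ((⇑φ)^[n] f)
    simp only [iterate_map_mul]
    rw [mul_assoc a, ← mul_assoc b, ← hb']
    simp only [mul_assoc]

lemma relIndex_le_of_mul (C A K : Subgroup G) (hK : (K : Set G).Finite) (hA : A ≤ K)
    (h : ∀ x ∈ K, ∃ a ∈ A, ∃ c ∈ C, x = a * c) : C.relIndex K ≤ C.relIndex A := by
  have : Finite A := hK.subset hA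
  unfold Subgroup.relIndex Subgroup.index
  have hmap : ∀ a b : A, (QuotientGroup.leftRel (C.subgroupOf A)) a b →
      (QuotientGroup.mk (Subgroup.inclusion hA a) : K ⧸ C.subgroupOf K) =
        QuotientGroup.mk (Subgroup.inclusion hA b) := by
    intro a b hab
    rw [QuotientGroup.leftRel_apply] at hab
    rw [QuotientGroup.eq]
    exact hab
  refine Nat.card_le_card_of_surjective
    (Quotient.lift (fun a : A => (QuotientGroup.mk (Subgroup.inclusion hA a) :
      K ⧸ C.subgroupOf K)) hmap) ?_
  intro q
  obtain ⟨⟨x, hx⟩, rfl⟩ := QuotientGroup.mk_surjective q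
  obtain ⟨a, ha, c, hc, rfl⟩ := h x hx
  refine ⟨Quotient.mk _ ⟨a, ha⟩, ?_⟩
  show (QuotientGroup.mk (Subgroup.inclusion hA ⟨a, ha⟩) : K ⧸ C.subgroupOf K) = _
  rw [QuotientGroup.eq]
  simpa [Subgroup.mem_subgroupOf] using hc

/-- Lift of a finite subgroup. -/
lemma exists_lift (N : Subgroup G) [N.Normal] (hN : IsLocallyFinite N)
    (S : Set G) (hS : S.Finite) (Fb : Subgroup (G ⧸ N)) (hFb : (Fb : Set (G ⧸ N)).Finite)
    (hSF : QuotientGroup.mk' N '' S ⊆ Fb) :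
    ∃ F : Subgroup G, S ⊆ F ∧ (F : Set G).Finite ∧ F.map (QuotientGroup.mk' N) = Fb := by
  set R : Set G := Quotient.out '' (Fb : Set (G ⧸ N)) with hR
  set F := Subgroup.closure (S ∪ R) with hFdef
  have hfin : (S ∪ R).Finite := hS.union (hFb.image _)
  have hmap : F.map (QuotientGroup.mk' N) = Fb := by
    apply le_antisymm
    · rw [hFdef, MonoidHom.map_closure, Subgroup.closure_le, Set.image_union]
      refine Set.union_subset hSF ?_
      rintro _ ⟨_, ⟨q, hq, rfl⟩, rfl⟩
      simpa using hq
    · intro q hq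
      exact ⟨q.out, Subgroup.subset_closure (Or.inr ⟨q, hq, rfl⟩), by simp⟩
  refine ⟨F, fun x hx => Subgroup.subset_closure (Or.inl hx), ?_, hmap⟩
  have hfg : Group.FG F := by
    have : Finite (S ∪ R : Set G) := hfin
    exact Group.closure_finite_fg (S ∪ R)
  have hFI : (N.subgroupOf F).FiniteIndex := by
    refine ⟨?_⟩
    have h1 : N.relIndex F = Nat.card (F.map (QuotientGroup.mk' N)) := by
      rw [← Subgroup.relIndex_ker, QuotientGroup.ker_mk']
    change N.relIndex F ≠ 0
    rw [h1, hmap]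
    have : Finite Fb := hFb
    exact Nat.card_pos.ne'
  have hfg2 : Group.FG (N.subgroupOf F) := Subgroup.fg_of_index_ne_zero _
  -- the finite kernel
  have hker : Finite (N.subgroupOf F) := by
    let j : N.subgroupOf F →* N :=
      { toFun := fun x => ⟨x.1.1, x.2⟩, map_one' := rfl, map_mul' := fun _ _ => rfl }
    have hj : Function.Injective j := by
      intro x y hxy
      apply Subtype.ext
      apply Subtype.ext
      exact congrArg (fun z : N => (z : G)) hxy
    have hr : Group.FG j.range := Group.fg_range j
    obtain ⟨T, hT, hTf⟩ := (Subgroup.fg_iff _).1 ((Group.fg_iff_subgroup_fg _).1 hr)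
    have := hN T hTf
    rw [hT] at this
    have : Finite j.range := this
    exact Finite.of_injective j.rangeRestrict (fun a b h => hj (by simpa using congrArg Subtype.val h))
  have : Finite F := by
    have h2 : Finite (F ⧸ N.subgroupOf F) := inferInstance
    exact Finite.of_subgroup_quotient (N.subgroupOf F)
  exact this

lemma entTraj_succ' (φ : G →* G) (F : Set G) (n : ℕ) :
    entTraj φ F (n + 1) = F * φ '' entTraj φ F n := by
  induction n with
  | zero => simp [entTraj]
  | succ n ih =>
    have h1 : φ '' entTraj φ F (n + 1) =
        φ '' entTraj φ F n * (⇑φ)^[n + 1] '' F := by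
      rw [entTraj, Set.image_mul, Set.image_image]
      simp only [Function.iterate_succ_apply']
    rw [h1, ← mul_assoc, ← ih, entTraj]

end general

section comm
variable {A : Type*} [CommGroup A]

/-- Trajectories as subgroups, commutative case. -/
def W (φ : A →* A) (F : Subgroup A) : ℕ → Subgroup A
  | 0 => ⊥
  | n + 1 => F ⊔ (W φ F n).map φ

lemma W_coe (φ : A →* A) (F : Subgroup A) (n : ℕ) :
    (W φ F n : Set A) = entTraj φ (F : Set A) n := by
  induction n with
  | zero => simp [W, entTraj]
  | succ n ih => rw [W, entTraj_succ', Subgroup.mul_normal, Subgroup.coe_map, ih]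

lemma W_mono (φ : A →* A) (F : Subgroup A) (n : ℕ) : W φ F n ≤ W φ F (n + 1) := by
  induction n with
  | zero => exact bot_le
  | succ n ih => exact sup_le_sup_left (Subgroup.map_mono ih) F

lemma W_succ_succ (φ : A →* A) (F : Subgroup A) (n : ℕ) :
    W φ F (n + 2) = W φ F (n + 1) ⊔ (W φ F (n + 1)).map φ := by
  apply le_antisymm
  · exact sup_le_sup_right le_sup_left _
  · exact sup_le (W_mono φ F (n + 1)) le_sup_right

lemma card_sup (φ : A →* A) (F : Subgroup A) :
    Nat.card (F ⊔ F.map φ : Subgroup A) = Nat.card F * idx φ F := by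
  have h := Subgroup.relIndex_mul_relIndex (⊥ : Subgroup A) F (F ⊔ F.map φ) bot_le le_sup_left
  rw [Subgroup.relIndex_bot_left, Subgroup.relIndex_bot_left, Subgroup.relIndex_sup_left,
    ← Subgroup.relIndex_comap] at h
  exact h.symm

lemma W_finite (φ : A →* A) (F : Subgroup A) (hF : (F : Set A).Finite) (n : ℕ) :
    (W φ F n : Set A).Finite := by
  rw [W_coe]; exact entTraj_finite φ hF n

lemma idx_anti (φ : A →* A) (F : Subgroup A) (hF : (F : Set A).Finite) :
    idx φ (F ⊔ F.map φ) ≤ idx φ F := by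
  set C := (F ⊔ F.map φ).comap φ with hC
  have hFC : F ≤ C := by
    rw [hC, ← Subgroup.map_le_iff_le_comap]; exact le_sup_right
  have h1 : C.relIndex (C ⊔ F.map φ) = (C.comap φ).relIndex F := by
    rw [Subgroup.relIndex_sup_left, ← Subgroup.relIndex_comap]
  have h2 : (C.comap φ).relIndex F ≤ (F.comap φ).relIndex F :=
    Subgroup.relIndex_le_of_le_left (Subgroup.comap_mono hFC)
      (relIndex_ne_zero_of_finite _ _ hF)
  refine le_trans ?_ h2
  rw [← h1]
  refine Subgroup.relIndex_le_of_le_right (sup_le_sup_right hFC _) ?_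
  rw [h1]
  exact relIndex_ne_zero_of_finite _ _ hF

lemma good_comm (hA : ∀ S : Set A, S.Finite → (Subgroup.closure S : Set A).Finite)
    (φ : A →* A) : Good φ := by
  intro S hS
  set F₀ := Subgroup.closure S
  have hF₀ : (F₀ : Set A).Finite := hA S hS
  obtain ⟨m, hm⟩ : ∃ m, ∀ k, idx φ (W φ F₀ (m + 1)) ≤ idx φ (W φ F₀ (k + 1)) := by
    obtain ⟨m, hm⟩ := Nat.sInf_mem (Set.range_nonempty (fun k => idx φ (W φ F₀ (k + 1))))
    refine ⟨m, fun k => ?_⟩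
    have : idx φ (W φ F₀ (m + 1)) = _ := hm
    rw [this]
    exact Nat.sInf_le ⟨k, rfl⟩
  set F := W φ F₀ (m + 1) with hFdef
  have hF : (F : Set A).Finite := W_finite φ F₀ hF₀ _
  have hWW : ∀ k, W φ F (k + 1) = W φ F₀ (m + k + 1) := by
    intro k
    induction k with
    | zero => simp [W, hFdef]
    | succ k ih =>
      rw [W_succ_succ, ih]
      exact (W_succ_succ φ F₀ (m + k)).symm
  have hle : ∀ k, idx φ (W φ F₀ (m + k + 1)) ≤ idx φ F := by
    intro k
    induction k with
    | zero => exact le_rfl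
    | succ k ih =>
      refine le_trans ?_ ih
      have := idx_anti φ (W φ F₀ (m + k + 1)) (W_finite φ F₀ hF₀ _)
      rwa [← W_succ_succ] at this
  have heq : ∀ k, idx φ (W φ F₀ (m + k + 1)) = idx φ F := fun k => le_antisymm (hle k) (hm _)
  have hcard : ∀ k, Nat.card (W φ F (k + 1)) = Nat.card F * idx φ F ^ k := by
    intro k
    induction k with
    | zero => simp [W]
    | succ k ih => rw [W_succ_succ, card_sup, ih, hWW, heq, pow_succ, mul_assoc]
  have : Finite F := hF
  refine ⟨F, ?_, hF, ?_⟩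
  · exact fun x hx => (le_sup_left : F₀ ≤ _) (Subgroup.subset_closure hx)
  · intro n
    rcases n with _ | n
    · simp [entTraj]
    · rw [← W_coe, ← Nat.card_coe_set_eq]
      have h1 := hcard n
      have h2 : idx φ F ≤ Nat.card F :=
        Nat.le_of_dvd Nat.card_pos (Subgroup.relIndex_dvd_card _ _)
      calc idx φ F ^ (n + 1) = idx φ F * idx φ F ^ n := by ring
        _ ≤ Nat.card F * idx φ F ^ n := Nat.mul_le_mul_right _ h2
        _ = _ := h1.symm

lemma comm_locallyFinite (hA : IsMulTorsion A) (S : Set A) (hS : S.Finite) :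
    (Subgroup.closure S : Set A).Finite := by
  have : Finite S := hS
  have h1 : Group.FG (Subgroup.closure S) := Group.closure_finite_fg S
  have h2 : Finite (Subgroup.closure S) :=
    CommGroup.finite_of_fg_isMulTorsion _ (hA.subgroup _)
  exact h2

end comm

section step
variable {G : Type*} [Group G]

lemma good_step (φ : G →* G) (N : Subgroup G) [N.Normal] (hcen : N ≤ Subgroup.center G)
    (hN : N ≤ N.comap φ) (hlf : IsLocallyFinite N) (hgN : Good (endRestrict φ N hN))
    (hgQ : Good (QuotientGroup.map N N φ hN)) : Good φ := by
  intro S hS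
  set π := QuotientGroup.mk' N with hπ
  set ψ := QuotientGroup.map N N φ hN with hψ
  have hcomm : ∀ x, π (φ x) = ψ (π x) := fun x => rfl
  obtain ⟨Fb, hSFb, hFb, hFbg⟩ := hgQ (π '' S) (hS.image _)
  obtain ⟨F₁, hSF₁, hF₁, hmap⟩ := exists_lift N hlf S hS Fb hFb hSFb
  -- correction terms
  set K₀ : Set N := {k | ∃ f ∈ F₁, ∃ d ∈ F₁, (k : G) = f⁻¹ * φ d} with hK₀
  have hK₀f : K₀.Finite := by
    have : ((fun p : G × G => p.1⁻¹ * φ p.2) '' ((F₁ : Set G) ×ˢ (F₁ : Set G))).Finite :=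
      (hF₁.prod hF₁).image _
    refine Set.Finite.of_finite_image (f := (Subtype.val : N → G)) (this.subset ?_)
      Subtype.val_injective.injOn
    rintro _ ⟨k, ⟨f, hf, d, hd, h⟩, rfl⟩
    exact ⟨(f, d), ⟨hf, hd⟩, h.symm⟩
  obtain ⟨KN, hK₀K, hKN, hKNg⟩ := hgN K₀ hK₀f
  set K : Subgroup G := KN.map N.subtype with hK
  have hKcen : K ≤ Subgroup.center G := by
    rintro _ ⟨k, _, rfl⟩
    exact hcen k.2
  have hKleN : K ≤ N := by
    rintro _ ⟨k, _, rfl⟩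
    exact k.2
  have hKn : K.Normal := normal_of_le_center hKcen
  have hKf : (K : Set G).Finite := by
    rw [hK, Subgroup.coe_map]; exact hKN.image _
  set F := F₁ ⊔ K with hFdef
  have hFcoe : (F : Set G) = (F₁ : Set G) * (K : Set G) := Subgroup.mul_normal _ _
  have hFf : (F : Set G).Finite := by rw [hFcoe]; exact hF₁.mul hKf
  have hFmap : F.map π = Fb := by
    rw [hFdef, Subgroup.map_sup, hmap, sup_eq_left]
    rintro _ ⟨k, hk, rfl⟩
    have : π k = 1 := (QuotientGroup.eq_one_iff k).2 (hKleN hk)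
    rw [this]; exact Fb.one_mem
  -- index bound
  have hidx : idx φ F ≤ idx ψ Fb * idx (endRestrict φ N hN) KN := by
    set C := F.comap φ with hC
    set C' := (Fb.comap ψ).comap π with hC'
    have hCC' : C ≤ C' := by
      intro x hx
      show ψ (π x) ∈ Fb
      rw [← hcomm, ← hFmap]
      exact ⟨_, hx, rfl⟩
    have e1 : C'.relIndex F = idx ψ Fb := by
      rw [hC', Subgroup.relIndex_comap, hFmap]; rfl
    have e2 : C.relIndex (C' ⊓ F) * C'.relIndex F = C.relIndex F := by
      rw [Subgroup.relIndex_inf_mul_relIndex, inf_eq_left.2 hCC']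
    have hNC' : N ≤ C' := by
      intro x hx
      show ψ (π x) ∈ Fb
      have : π x = 1 := (QuotientGroup.eq_one_iff x).2 hx
      rw [this, map_one]; exact Fb.one_mem
    have e3 : C.relIndex (C' ⊓ F) ≤ C.relIndex K := by
      refine relIndex_le_of_mul C K (C' ⊓ F) (hFf.subset fun x hx => hx.2)
        (le_inf (hKleN.trans hNC') le_sup_right) ?_
      rintro x ⟨hx1, hx2⟩
      have hx2' : x ∈ (F : Set G) := hx2
      rw [hFcoe] at hx2'
      obtain ⟨f, hf, k, hk, rfl⟩ := hx2'
      refine ⟨k, hk, f, ?_, Subgroup.mem_center_iff.1 (hKcen hk) f⟩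
      have hfC' : f ∈ C' := (Subgroup.mul_mem_cancel_right C' (hNC' (hKleN hk))).1 hx1
      have h3 : π (φ f) ∈ Fb := hfC'
      rw [← hmap] at h3
      obtain ⟨g, hg, hgf⟩ := h3
      have hgN : g⁻¹ * φ f ∈ N := QuotientGroup.eq.1 hgf
      have hk' : (⟨g⁻¹ * φ f, hgN⟩ : N) ∈ KN := hK₀K ⟨g, hg, f, hf, rfl⟩
      show φ f ∈ F
      have : φ f = g * (g⁻¹ * φ f) := by group
      rw [this]
      exact F.mul_mem ((le_sup_left : F₁ ≤ F) hg)
        ((le_sup_right : K ≤ F) ⟨_, hk', rfl⟩)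
    have e4 : C.relIndex K ≤ idx (endRestrict φ N hN) KN := by
      rw [hK, ← Subgroup.relIndex_comap]
      refine Subgroup.relIndex_le_of_le_left ?_ (relIndex_ne_zero_of_finite _ _ hKN)
      intro x hx
      exact (le_sup_right : K ≤ F) ⟨_, hx, rfl⟩
    show C.relIndex F ≤ _
    rw [← e2, e1, mul_comm]
    exact Nat.mul_le_mul_left _ (e3.trans e4)
  refine ⟨F, fun x hx => (le_sup_left : F₁ ≤ F) (hSF₁ hx), hFf, fun n => ?_⟩
  -- trajectory bound
  have him : π '' entTraj φ (F : Set G) n = entTraj ψ (Fb : Set (G ⧸ N)) n := by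
    rw [image_entTraj φ ψ π hcomm, ← Subgroup.coe_map, hFmap]
  have himK : N.subtype '' entTraj (endRestrict φ N hN) (KN : Set N) n =
      entTraj φ (K : Set G) n := by
    rw [image_entTraj (endRestrict φ N hN) φ N.subtype (fun x => rfl), ← Subgroup.coe_map]
  have hiter : ∀ n, ∀ x ∈ (K : Set G), (⇑φ)^[n] x ∈ Subgroup.center G := by
    intro n x hx
    apply hcen
    have : ∀ n, (⇑φ)^[n] x ∈ N := by
      intro n
      induction n with
      | zero => exact hKleN hx
      | succ n ih => rw [Function.iterate_succ_apply']; exact hN ih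
    exact this n
  have hmul := entTraj_mul_central φ F (K : Set G) (le_sup_right : K ≤ F) hiter n
  have hex : ∀ q ∈ entTraj ψ (Fb : Set (G ⧸ N)) n, ∃ x ∈ entTraj φ (F : Set G) n, π x = q := by
    intro q hq
    rwa [← him] at hq
  choose! s hs1 hs2 using hex
  have hcard : (entTraj ψ (Fb : Set (G ⧸ N)) n).ncard *
      (entTraj (endRestrict φ N hN) (KN : Set N) n).ncard ≤
      (entTraj φ (F : Set G) n).ncard := by
    rw [← Set.ncard_prod]
    refine Set.ncard_le_ncard_of_injOn (fun p => s p.1 * (p.2 : G)) ?_ ?_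
      (entTraj_finite φ hFf n)
    · rintro ⟨q, k⟩ ⟨hq, hk⟩
      refine hmul ⟨s q, hs1 q hq, k, ?_, rfl⟩
      rw [← himK]
      exact ⟨k, hk, rfl⟩
    · rintro ⟨q, k⟩ ⟨hq, hk⟩ ⟨q', k'⟩ ⟨hq', hk'⟩ h
      simp only at h hq hq'
      have hone : ∀ k : N, π (k : G) = 1 := fun k => (QuotientGroup.eq_one_iff (k : G)).2 k.2
      have h1 : q = q' := by
        have := congrArg π h
        rwa [map_mul, map_mul, hone, hone, mul_one, mul_one, hs2 q hq, hs2 q' hq'] at this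
      subst h1
      have h2 : (k : G) = k' := mul_left_cancel h
      rw [Subtype.ext h2]
  calc idx φ F ^ n ≤ (idx ψ Fb * idx (endRestrict φ N hN) KN) ^ n := Nat.pow_le_pow_left hidx n
    _ = idx ψ Fb ^ n * idx (endRestrict φ N hN) KN ^ n := mul_pow _ _ _
    _ ≤ _ := Nat.mul_le_mul (hFbg n) (hKNg n)
    _ ≤ _ := hcard

end step

open scoped commutatorElement in
theorem good_nilpotent (c : ℕ) : ∀ {G : Type*} [Group G], IsMulTorsion G →
    (⊤ : Subgroup G).lowerCentralSeries c = ⊥ → ∀ φ : G →* G, Good φ := by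
  induction c with
  | zero =>
    intro G _ htor h φ S hS
    have htriv : ∀ x : G, x = 1 := fun x => by
      have : x ∈ (⊤ : Subgroup G).lowerCentralSeries 0 := Subgroup.mem_top x
      rw [h] at this
      exact this
    refine ⟨⊥, fun x _ => htriv x, by simp, fun n => ?_⟩
    have : idx φ ⊥ = 1 := by simp [idx]
    rw [this, one_pow]
    exact entTraj_ncard_pos φ ⊥ (by simp) n
  | succ c ih =>
    intro G _ htor h φ
    set N := (⊤ : Subgroup G).lowerCentralSeries c with hNdef
    have hcen : N ≤ Subgroup.center G := by
      intro x hx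
      rw [Subgroup.mem_center_iff]
      intro g
      have h1 : ⁅x, g⁆ ∈ (⊤ : Subgroup G).lowerCentralSeries (c + 1) :=
        Subgroup.commutator_mem_commutator hx (Subgroup.mem_top g)
      rw [h, Subgroup.mem_bot, commutatorElement_eq_one_iff_mul_comm] at h1
      exact h1.symm
    have hNn : N.Normal := normal_of_le_center hcen
    have hN : N ≤ N.comap φ := lowerCentralSeries_le_comap φ c
    have hNtor : IsMulTorsion N := htor.subgroup N
    let _ : CommGroup N :=
      { (inferInstance : Group N) with
        mul_comm := fun a b => Subtype.ext (Subgroup.mem_center_iff.1 (hcen b.2) a) }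
    have hlf : IsLocallyFinite N := comm_locallyFinite hNtor
    refine good_step φ N hcen hN hlf (good_comm hlf _) (ih ?_ ?_ _)
    · exact htor.of_surjective (QuotientGroup.mk'_surjective N)
    · rw [← Subgroup.map_top_of_surjective _ (QuotientGroup.mk'_surjective N),
        ← Subgroup.map_lowerCentralSeries, ← hNdef, QuotientGroup.map_mk'_self]

end AlgEntropy

/-- If `G` is torsion nilpotent and `φ` is an endomorphism of `G`
with finite algebraic entropy, then `h(φ) = log α` for some positive integer `α`. -/
theorem algEnt_eq_log_nat {G : Type*} [Group G] (htor : Monoid.IsTorsion G)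
    [Group.IsNilpotent G] (φ : G →* G) (hfin : AlgEntropy.algEnt φ < ⊤) :
    ∃ α : ℕ+, AlgEntropy.algEnt φ = ENNReal.ofReal (Real.log α) := by
  obtain ⟨n, hn⟩ := Subgroup.nilpotent_iff_lowerCentralSeries.1 (inferInstance : Group.IsNilpotent G)
  exact AlgEntropy.final φ (AlgEntropy.good_nilpotent n htor hn φ) hfin
end
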